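/- Let K > 2, let n ≥ 1, let π ∈ P^n be a preference profile and ≻₀ ∈ P a linear order. If π exhibits consensus of level (K−1)! around ≻₀, then π exhibits consensus of level 1 around ≻₀. -/

import Mathlib

open Finset

/-- Preference relations on `K` alternatives, encoded as rankings, i.e. permutations
`σ` of `Fin K`: alternative `a` is preferred to `b` (`a ≻ b`) iff `σ a > σ b`.
These are in natural bijection with the `K!` linear orders on a `K`-element set. -/
abbrev Pref (K : ℕ) := Equiv.Perm (Fin K)

/-- The inversion metric `d(≻,≻') = |≻ \ ≻'|`: the number of (unordered) pairs of
alternatives on which the two linear orders disagree. -/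
def invDist {K : ℕ} (σ τ : Pref K) : ℕ :=
  (Finset.univ.filter fun p : Fin K × Fin K =>
    p.1 < p.2 ∧ ((σ p.1 < σ p.2) ↔ ¬ (τ p.1 < τ p.2))).card

/-- The reverse `⊽≻₀` of a preference relation `≻₀`: `a ⊽≻₀ b` iff `b ≻₀ a`. -/
def revPref {K : ℕ} (σ : Pref K) : Pref K := σ.trans Fin.revPerm

/-- The Mahonian number `T(K,k)`: the number of permutations of `{1,…,K}` with
exactly `k` inversions. -/
def mahonian (K k : ℕ) : ℕ :=
  (Finset.univ.filter fun σ : Pref K => invDist σ (Equiv.refl (Fin K)) = k).card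

/-- `c' = |{k ∈ ℕ : T(K,k) is odd}|`. -/
noncomputable def oddMahonianCount (K : ℕ) : ℕ := {k : ℕ | Odd (mahonian K k)}.ncard

/-- `P_k(≻₀) = {≻ ∈ P : d(≻,≻₀) = k}`. -/
def distSphere {K : ℕ} (σ₀ : Pref K) (k : ℕ) : Finset (Pref K) :=
  Finset.univ.filter fun σ => invDist σ σ₀ = k

/-- `C ≥_{≻₀} C'` : `C` is at least as close to `≻₀` as `C'`. -/
def AtLeastAsClose {K : ℕ} (σ₀ : Pref K) (C C' : Finset (Pref K)) : Prop :=
  ∃ φ : Pref K → Pref K, Set.InjOn φ ↑C ∧ (∀ σ ∈ C, φ σ ∈ C') ∧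
    ∀ σ ∈ C, invDist σ σ₀ ≤ invDist (φ σ) σ₀

/-- `C >_{≻₀} C'` : `C` is closer than `C'` to `≻₀`. -/
def Closer {K : ℕ} (σ₀ : Pref K) (C C' : Finset (Pref K)) : Prop :=
  ∃ φ : Pref K → Pref K, Set.InjOn φ ↑C ∧ (∀ σ ∈ C, φ σ ∈ C') ∧
    (∀ σ ∈ C, invDist σ σ₀ ≤ invDist (φ σ) σ₀) ∧
    ∃ σ ∈ C, invDist σ σ₀ < invDist (φ σ) σ₀

/-- `μ_π(≻) = |{i : ≻ᵢ = ≻}|`. -/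
def muRel {K n : ℕ} (π : Fin n → Pref K) (σ : Pref K) : ℕ :=
  (Finset.univ.filter fun i => π i = σ).card

/-- `μ_π(C) = |{i : ≻ᵢ ∈ C}|`. -/
def muSet {K n : ℕ} (π : Fin n → Pref K) (C : Finset (Pref K)) : ℕ :=
  (Finset.univ.filter fun i => π i ∈ C).card

/-- The profile `π` exhibits consensus of level `r` around `≻₀`. -/
def ConsensusLevel {K n : ℕ} (π : Fin n → Pref K) (r : ℕ) (σ₀ : Pref K) : Prop :=
  (∀ C C' : Finset (Pref K), Disjoint C C' → C.card = r → C'.card = r →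
      AtLeastAsClose σ₀ C C' → muSet π C' ≤ muSet π C) ∧
  (∃ C C' : Finset (Pref K), Disjoint C C' ∧ C.card = r ∧ C'.card = r ∧
      Closer σ₀ C C' ∧ muSet π C' < muSet π C)

/-- `(C₁, C₂)` is an `m`-balanced pair around `≻₀`. -/
def BalancedPair {K : ℕ} (σ₀ : Pref K) (m : ℕ) (C₁ C₂ : Finset (Pref K)) : Prop :=
  Disjoint C₁ C₂ ∧ C₁.card = m ∧ C₂.card = m ∧
    ∀ k ≤ K * (K - 1) / 2,
      (C₁.filter fun σ => invDist σ σ₀ = k).card =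
      (C₂.filter fun σ => invDist σ σ₀ = k).card

theorem muSet_eq_sum {K n : ℕ} (π : Fin n → Pref K) (C : Finset (Pref K)) :
    muSet π C = ∑ σ ∈ C, muRel π σ := by
  unfold muSet muRel
  rw [Finset.card_eq_sum_card_fiberwise (f := π) (t := C) (by intro i hi; simpa using hi)]
  refine Finset.sum_congr rfl fun σ hσ => congrArg Finset.card ?_
  ext i
  simp only [Finset.mem_filter, Finset.mem_univ, true_and, and_iff_right_iff_imp]
  rintro rfl
  exact hσ

theorem AtLeastAsClose.insert {K : ℕ} {σ₀ σ τ : Pref K} {C C' : Finset (Pref K)}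
    (h : AtLeastAsClose σ₀ C C') (hσ : σ ∉ C) (hτ : τ ∉ C')
    (hle : invDist σ σ₀ ≤ invDist τ σ₀) :
    AtLeastAsClose σ₀ (insert σ C) (insert τ C') := by
  obtain ⟨φ, hinj, hmem, hdist⟩ := h
  have hne : ∀ ρ ∈ C, ρ ≠ σ := fun ρ hρ h => hσ (h ▸ hρ)
  have hval : ∀ ρ ∈ C, Function.update φ σ τ ρ = φ ρ := fun ρ hρ =>
    Function.update_of_ne (hne ρ hρ) _ _
  refine ⟨Function.update φ σ τ, ?_, ?_, ?_⟩
  · rw [Finset.coe_insert, Set.injOn_insert (by simpa using hσ)]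
    refine ⟨fun a ha b hb hab => hinj ha hb ?_, ?_⟩
    · rwa [hval a ha, hval b hb] at hab
    · rintro ⟨ρ, hρ, heq⟩
      rw [hval ρ hρ, Function.update_self] at heq
      exact hτ (heq ▸ hmem ρ hρ)
  · intro ρ hρ
    rcases Finset.mem_insert.1 hρ with rfl | hρ
    · simp
    · rw [hval ρ hρ]
      exact Finset.mem_insert_of_mem (hmem ρ hρ)
  · intro ρ hρ
    rcases Finset.mem_insert.1 hρ with rfl | hρ
    · simpa using hle
    · rw [hval ρ hρ]
      exact hdist ρ hρ

theorem AtLeastAsClose.empty {K : ℕ} (σ₀ : Pref K) : AtLeastAsClose σ₀ ∅ ∅ :=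
  ⟨id, by simp, by simp, by simp⟩

theorem AtLeastAsClose.singleton {K : ℕ} {σ₀ σ τ : Pref K}
    (h : invDist σ σ₀ ≤ invDist τ σ₀) : AtLeastAsClose σ₀ {σ} {τ} := by
  simpa using (AtLeastAsClose.empty σ₀).insert (by simp) (by simp) h

theorem invDist_lt {K : ℕ} (σ τ : Pref K) : invDist σ τ < K * K / 2 + 1 := by
  have hle : invDist σ τ ≤ (univ.filter fun p : Fin K × Fin K => p.1 < p.2).card :=
    Finset.card_le_card fun p hp => by
      simp only [Finset.mem_filter, Finset.mem_univ, true_and] at hp ⊢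
      exact hp.1
  have hswap : (univ.filter fun p : Fin K × Fin K => p.1 < p.2).card =
      (univ.filter fun p : Fin K × Fin K => p.2 < p.1).card :=
    Finset.card_equiv (Equiv.prodComm _ _) (by simp)
  have hdisj : Disjoint (univ.filter fun p : Fin K × Fin K => p.1 < p.2)
      (univ.filter fun p : Fin K × Fin K => p.2 < p.1) :=
    Finset.disjoint_filter.2 fun p _ h h' => lt_asymm h h'
  have htotal := Finset.card_le_univ
    ((univ.filter fun p : Fin K × Fin K => p.1 < p.2) ∪
      (univ.filter fun p : Fin K × Fin K => p.2 < p.1))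
  rw [Finset.card_union_of_disjoint hdisj, Fintype.card_prod, Fintype.card_fin] at htotal
  omega

/-- A large enough set of preferences contains two disjoint sets of size `m`, each at least as
close to `σ₀` as the other. -/
theorem exists_equally_close {K : ℕ} (σ₀ : Pref K) (m : ℕ) (U : Finset (Pref K))
    (hU : 2 * m + (K * K / 2 + 1) ≤ U.card + 1) :
    ∃ C C' : Finset (Pref K), C ⊆ U ∧ C' ⊆ U ∧ Disjoint C C' ∧ C.card = m ∧ C'.card = m ∧
      AtLeastAsClose σ₀ C C' ∧ AtLeastAsClose σ₀ C' C := by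
  induction m generalizing U with
  | zero => exact ⟨∅, ∅, by simp, by simp, by simp, rfl, rfl, .empty σ₀, .empty σ₀⟩
  | succ m ih =>
    obtain ⟨x, hx, y, hy, hxy, hd⟩ := Finset.exists_ne_map_eq_of_card_lt_of_maps_to
      (s := U) (t := Finset.range (K * K / 2 + 1)) (f := fun σ => invDist σ σ₀)
      (by rw [Finset.card_range]; omega)
      (by intro σ _; simpa using invDist_lt σ σ₀)
    have hy' : y ∈ U.erase x := Finset.mem_erase.2 ⟨hxy.symm, hy⟩
    obtain ⟨C, C', hC, hC', hdisj, hcard, hcard', hle, hle'⟩ := ih ((U.erase x).erase y) (by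
      rw [Finset.card_erase_of_mem hy', Finset.card_erase_of_mem hx]
      omega)
    have hx₁ : x ∉ C := fun h => by simpa using hC h
    have hx₂ : x ∉ C' := fun h => by simpa using hC' h
    have hy₁ : y ∉ C := fun h => by simpa using hC h
    have hy₂ : y ∉ C' := fun h => by simpa using hC' h
    have hsub : (U.erase x).erase y ⊆ U := (Finset.erase_subset _ _).trans (Finset.erase_subset _ _)
    refine ⟨insert x C, insert y C', Finset.insert_subset hx (hC.trans hsub),
      Finset.insert_subset hy (hC'.trans hsub), ?_, ?_, ?_,
      hle.insert hx₁ hy₂ hd.le, hle'.insert hy₂ hx₁ hd.ge⟩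
    · simp [hxy.symm, hx₂, hy₁, hdisj]
    · rw [Finset.card_insert_of_notMem hx₁, hcard]
    · rw [Finset.card_insert_of_notMem hy₂, hcard']

/-- Comparing `C ∪ {σ}` with `C' ∪ {τ}` and `C' ∪ {σ}` with `C ∪ {τ}` cancels `C` and `C'`. -/
theorem muRel_le_of_equally_close {K n r : ℕ} {π : Fin n → Pref K} {σ₀ σ τ : Pref K}
    (h : ∀ C C' : Finset (Pref K), Disjoint C C' → C.card = r + 1 → C'.card = r + 1 →
      AtLeastAsClose σ₀ C C' → muSet π C' ≤ muSet π C)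
    (hne : σ ≠ τ) (hd : invDist σ σ₀ ≤ invDist τ σ₀) {C C' : Finset (Pref K)}
    (hσ : σ ∉ C) (hτ : τ ∉ C) (hσ' : σ ∉ C') (hτ' : τ ∉ C') (hdisj : Disjoint C C')
    (hcard : C.card = r) (hcard' : C'.card = r)
    (hle : AtLeastAsClose σ₀ C C') (hle' : AtLeastAsClose σ₀ C' C) :
    muRel π τ ≤ muRel π σ := by
  have h₁ := h (insert σ C) (insert τ C') (by simp [hne.symm, hσ', hτ, hdisj])
    (by rw [Finset.card_insert_of_notMem hσ, hcard])
    (by rw [Finset.card_insert_of_notMem hτ', hcard']) (hle.insert hσ hτ' hd)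
  have h₂ := h (insert σ C') (insert τ C) (by simp [hne.symm, hσ, hτ', hdisj.symm])
    (by rw [Finset.card_insert_of_notMem hσ', hcard'])
    (by rw [Finset.card_insert_of_notMem hτ, hcard]) (hle'.insert hσ' hτ hd)
  simp only [muSet_eq_sum, Finset.sum_insert hσ, Finset.sum_insert hτ,
    Finset.sum_insert hσ', Finset.sum_insert hτ'] at h₁ h₂
  omega

theorem sq_half_lt_sub_two_mul_factorial {K : ℕ} (hK : 4 ≤ K) :
    2 * ((K - 1).factorial - 1) + (K * K / 2 + 1) ≤ K.factorial - 2 + 1 := by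
  obtain ⟨m, rfl⟩ := Nat.exists_eq_add_of_le' hK
  have hfac : (m + 3) * (m + 2) ≤ (m + 3).factorial := by
    rw [Nat.factorial_succ, Nat.factorial_succ]
    exact Nat.mul_le_mul_left _ (Nat.le_mul_of_pos_right _ (Nat.factorial_pos _))
  have hsucc : (m + 4).factorial = (m + 4) * (m + 3).factorial := Nat.factorial_succ _
  have hlow : (m + 4) * (m + 4) / 2 + 2 ≤ (m + 2) * (m + 3).factorial := by
    have := Nat.mul_le_mul_left (m + 2) hfac
    have : (m + 4) * (m + 4) / 2 ≤ (m + 4) * (m + 4) := Nat.div_le_self _ _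
    have h2 : (m + 4) * (m + 4) / 2 * 2 ≤ (m + 4) * (m + 4) := Nat.div_mul_le_self _ _
    nlinarith
  have hpos := Nat.factorial_pos (m + 3)
  have hsplit : (m + 4) * (m + 3).factorial =
      (m + 2) * (m + 3).factorial + 2 * (m + 3).factorial := by ring
  rw [show m + 4 - 1 = m + 3 from rfl]
  omega

set_option synthInstance.maxSize 2000 in
/-- On three alternatives, either two preferences other than `σ` and `τ` are equidistant from `σ₀`,
or `σ` and `τ` are each equidistant with a further preference. -/
theorem exists_equidistant_three : ∀ σ₀ σ τ : Pref 3, σ ≠ τ →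
    (∃ x y : Pref 3, x ≠ y ∧ σ ≠ x ∧ τ ≠ x ∧ σ ≠ y ∧ τ ≠ y ∧ invDist x σ₀ = invDist y σ₀) ∨
    (∃ x y : Pref 3, x ≠ y ∧ σ ≠ x ∧ τ ≠ x ∧ σ ≠ y ∧ τ ≠ y ∧ invDist x σ₀ = invDist σ σ₀ ∧
      invDist y σ₀ = invDist τ σ₀) := by
  decide +kernel

theorem muRel_le_of_three {n : ℕ} {π : Fin n → Pref 3} {σ₀ σ τ : Pref 3}
    (h : ∀ C C' : Finset (Pref 3), Disjoint C C' → C.card = 2 → C'.card = 2 →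
      AtLeastAsClose σ₀ C C' → muSet π C' ≤ muSet π C)
    (hne : σ ≠ τ) (hd : invDist σ σ₀ ≤ invDist τ σ₀) : muRel π τ ≤ muRel π σ := by
  have close_of_ne : ∀ {a b c d : Pref 3}, a ≠ b → a ≠ c → a ≠ d → b ≠ c → b ≠ d → c ≠ d →
      invDist a σ₀ ≤ invDist c σ₀ → invDist b σ₀ = invDist d σ₀ →
      muRel π c ≤ muRel π a := by
    intro a b c d hab hac had hbc hbd hcd h₁ h₂
    exact muRel_le_of_equally_close h hac h₁ (C := {b}) (C' := {d}) (by simpa)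
      (by simpa using hbc.symm) (by simpa) (by simpa) (by simpa) rfl rfl
      (.singleton h₂.le) (.singleton h₂.ge)
  rcases exists_equidistant_three σ₀ σ τ hne with
    ⟨x, y, hxy, hσx, hτx, hσy, hτy, hd'⟩ | ⟨x, y, hxy, hσx, hτx, hσy, hτy, hx, hy⟩
  · exact close_of_ne hσx hne hσy hτx.symm hxy hτy hd hd'
  · have hσ := close_of_ne hne hσx hσy hτx hτy hxy hx.ge hy.symm
    have hτ := close_of_ne hxy.symm hτy.symm hσy.symm hτx.symm hσx.symm hne.symm hy.le hx
    have hpair := h {σ, x} {τ, y} (by simp [*, Ne.symm]) (Finset.card_pair hσx)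
      (Finset.card_pair hτy)
      ((AtLeastAsClose.singleton (by omega : invDist x σ₀ ≤ invDist y σ₀)).insert
        (by simpa) (by simpa) hd)
    rw [muSet_eq_sum, muSet_eq_sum, Finset.sum_pair hσx, Finset.sum_pair hτy] at hpair
    omega

theorem muRel_le_of_invDist_le {K n : ℕ} (hK : 2 < K) {π : Fin n → Pref K} {σ₀ σ τ : Pref K}
    (h : ∀ C C' : Finset (Pref K), Disjoint C C' → C.card = (K - 1).factorial →
      C'.card = (K - 1).factorial → AtLeastAsClose σ₀ C C' → muSet π C' ≤ muSet π C)
    (hd : invDist σ σ₀ ≤ invDist τ σ₀) : muRel π τ ≤ muRel π σ := by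
  rcases eq_or_ne σ τ with rfl | hne
  · exact le_rfl
  obtain rfl | hK4 : K = 3 ∨ 4 ≤ K := by omega
  · exact muRel_le_of_three h hne hd
  have hτ : τ ∈ (univ : Finset (Pref K)).erase σ := by simp [hne.symm]
  obtain ⟨C, C', hC, hC', hdisj, hcard, hcard', hle, hle'⟩ :=
    exists_equally_close σ₀ ((K - 1).factorial - 1) ((univ.erase σ).erase τ) (by
      rw [Finset.card_erase_of_mem hτ, Finset.card_erase_of_mem (Finset.mem_univ _),
        Finset.card_univ, Fintype.card_perm, Fintype.card_fin]
      exact sq_half_lt_sub_two_mul_factorial hK4)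
  rw [← Nat.sub_add_cancel (Nat.factorial_pos (K - 1))] at h
  exact muRel_le_of_equally_close h hne hd (fun hm => by simpa using hC hm)
    (fun hm => by simpa using hC hm) (fun hm => by simpa using hC' hm)
    (fun hm => by simpa using hC' hm) hdisj hcard hcard' hle hle'

/-- level `(K-1)!` consensus implies level `1` consensus. -/
theorem stmt1 (K n : ℕ) (hK : 2 < K) (hn : 1 ≤ n)
    (π : Fin n → Pref K) (σ₀ : Pref K)
    (h : ConsensusLevel π (K - 1).factorial σ₀) :
    ConsensusLevel π 1 σ₀ := by
  have hmono : ∀ σ τ : Pref K, invDist σ σ₀ ≤ invDist τ σ₀ → muRel π τ ≤ muRel π σ :=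
    fun _ _ hd => muRel_le_of_invDist_le hK h.1 hd
  constructor
  · intro C C' _ hC hC' hle
    obtain ⟨σ, rfl⟩ := Finset.card_eq_one.1 hC
    obtain ⟨τ, rfl⟩ := Finset.card_eq_one.1 hC'
    obtain ⟨φ, -, hmem, hdist⟩ := hle
    have hφ : φ σ = τ := by simpa using hmem σ (by simp)
    simpa [muSet_eq_sum] using hmono σ τ (hφ ▸ hdist σ (by simp))
  · obtain ⟨C, C', -, hC, hC', ⟨φ, hinj, hmem, hdist, -⟩, hlt⟩ := h.2
    have himage : C.image φ = C' := Finset.eq_of_subset_of_card_le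
      (Finset.image_subset_iff.2 hmem) (by rw [Finset.card_image_of_injOn hinj, hC, hC'])
    rw [muSet_eq_sum, muSet_eq_sum, ← himage, Finset.sum_image hinj] at hlt
    obtain ⟨σ, hσ, hσlt⟩ := Finset.exists_lt_of_sum_lt hlt
    have hd : invDist σ σ₀ < invDist (φ σ) σ₀ := by
      by_contra hcon
      exact (hmono (φ σ) σ (not_lt.1 hcon)).not_gt hσlt
    have hne : σ ≠ φ σ := fun heq => hd.ne (congrArg (invDist · σ₀) heq)
    exact ⟨{σ}, {φ σ}, by simpa using hne, rfl, rfl,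
      ⟨φ, by simp, by simp, by simpa using hd.le, by simpa using hd⟩,
      by simpa [muSet_eq_sum] using hσlt⟩
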